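/- Let G be a forest. Then for every k, there exists a balanced k-partition that is simultaneously MMS and EFX, even when each agent's utility function over sets of agents is merely monotone (with u_a(S) depending only on S ∩ Fr(a)). -/

import Mathlib

open Finset

variable {V : Type*} [Fintype V] [DecidableEq V]

/-- The `i`-th part of the `k`-partition given by `π`. -/
def cell {k : ℕ} (π : V → Fin k) (i : Fin k) : Finset V :=
  Finset.univ.filter fun v => π v = i

/-- A `k`-partition is balanced if every part has size `⌊n/k⌋` or `⌈n/k⌉`. -/
def IsBalanced {k : ℕ} (π : V → Fin k) : Prop :=
  ∀ i : Fin k, Fintype.card V / k ≤ (cell π i).card ∧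
    (cell π i).card ≤ (Fintype.card V + k - 1) / k


theorem orient {V : Type*} (F : SimpleGraph V) (hF : F.IsTree) (r : V) :
    ∃ (par : V → V) (dep : V → ℕ), (∀ v, v ≠ r → dep v = dep (par v) + 1) ∧
      ∀ v w, F.Adj v w → (v ≠ r ∧ par v = w) ∨ (w ≠ r ∧ par w = v) := by
  classical
  choose p hp hu using fun v => hF.existsUnique_path v r
  refine ⟨fun v => (p v).snd, fun v => (p v).length, ?_, ?_⟩
  · intro v hv
    have hnn : ¬ (p v).Nil := SimpleGraph.Walk.not_nil_of_ne hv
    have h1 := hu _ (p v).tail (hp v).tail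
    have h2 := SimpleGraph.Walk.length_tail_add_one hnn
    simp only
    rw [← h1]; omega
  · intro v w hvw
    by_cases hw : w ∈ (p v).support
    · left
      refine ⟨?_, (hF.isAcyclic.eq_snd_of_adj_start (hp v) hvw hw).symm⟩
      rintro rfl
      have := hu v .nil (by simp)
      rw [← this] at hw
      simp at hw
      exact hvw.ne hw.symm
    · right
      have h1 := hu w (.cons hvw.symm (p v)) (by
        beta_reduce
        rw [SimpleGraph.Walk.cons_isPath_iff]; exact ⟨hp v, hw⟩)
      refine ⟨?_, ?_⟩
      · rintro rfl
        exact hw (by simp)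
      · beta_reduce
        rw [← h1]; simp

/-- equitable 0/1 matrices with prescribed row sums -/
theorem equitable {V J : Type*} [DecidableEq V] [DecidableEq J] (U : Finset J) (C : Finset V)
    (e : V → ℕ) : ∀ (N : ℕ) (t : J → ℕ), (∀ y ∈ C, e y ≤ #U) →
    (∀ j ∈ U, t j = N ∨ t j = N + 1) → ∑ j ∈ U, t j = ∑ y ∈ C, e y →
    ∃ T : V → Finset J, (∀ y ∈ C, T y ⊆ U ∧ #(T y) = e y) ∧
      ∀ j ∈ U, #{y ∈ C | j ∈ T y} = t j := by
  induction C using Finset.induction_on with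
  | empty =>
    intro N t _ _ hs
    refine ⟨fun _ => ∅, by simp, ?_⟩
    intro j hj
    simp at hs
    simp [hs j hj]
  | insert a C ha ih =>
    intro N t he ht hs
    rw [Finset.sum_insert ha] at hs
    -- choose the row `a`
    obtain ⟨A, hAU, hAc, N', hA⟩ : ∃ A ⊆ U, #A = e a ∧ ∃ N', ∀ j ∈ U,
        (if j ∈ A then 1 else 0) ≤ t j ∧
        (t j - (if j ∈ A then 1 else 0) = N' ∨ t j - (if j ∈ A then 1 else 0) = N' + 1) := by
      set B := {j ∈ U | t j = N + 1} with hB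
      by_cases hc : e a ≤ #B
      · obtain ⟨A, hAB, hAc⟩ := Finset.exists_subset_card_eq hc
        refine ⟨A, hAB.trans (Finset.filter_subset _ _), hAc, N, ?_⟩
        intro j hj
        split_ifs with h
        · have := hAB h
          simp [hB] at this
          omega
        · have := ht j hj
          omega
      · obtain ⟨A, hBA, hAU, hAc⟩ := Finset.exists_subsuperset_card_eq
          (Finset.filter_subset (fun j => t j = N + 1) U) (not_le.1 hc).le (he a (by simp))
        have hN : 1 ≤ N := by
          by_contra h0
          have h0 : N = 0 := by omega
          subst h0
          have : ∑ j ∈ U, t j = #B := by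
            rw [hB, Finset.card_filter]
            apply Finset.sum_congr rfl
            intro j hj
            have := ht j hj
            split_ifs <;> omega
          omega
        refine ⟨A, hAU, hAc, N - 1, ?_⟩
        intro j hj
        have := ht j hj
        split_ifs with h
        · omega
        · have : ¬ t j = N + 1 := fun h' => h (hBA (by simp [hj, h']))
          omega
    obtain ⟨T, hT1, hT2⟩ := ih N' (fun j => t j - (if j ∈ A then 1 else 0))
      (fun y hy => he y (by simp [hy])) (fun j hj => (hA j hj).2) (by
        have h1 : ∑ j ∈ U, (t j - (if j ∈ A then 1 else 0)) + ∑ j ∈ U, (if j ∈ A then 1 else 0)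
            = ∑ j ∈ U, t j := by
          rw [← Finset.sum_add_distrib]
          exact Finset.sum_congr rfl fun j hj => Nat.sub_add_cancel (hA j hj).1
        have h2 : ∑ j ∈ U, (if j ∈ A then 1 else 0) = e a := by
          rw [← Finset.card_filter, ← hAc, Finset.filter_mem_eq_inter,
            Finset.inter_eq_right.2 hAU]
        omega)
    refine ⟨fun y => if y = a then A else T y, ?_, ?_⟩
    · intro y hy
      by_cases h : y = a
      · subst h; simp [hAU, hAc]
      · simp only [h, if_false]
        exact hT1 y (by simpa [h] using hy)
    · intro j hj
      have h1 : #{y ∈ C | j ∈ (if y = a then A else T y)} = #{y ∈ C | j ∈ T y} := by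
        congr 1
        apply Finset.filter_congr
        intro y hy
        have : y ≠ a := fun h => ha (h ▸ hy)
        simp [this]
      rw [Finset.filter_insert]
      have h2 := hT2 j hj
      have h3 := (hA j hj).1
      simp only [if_true]
      split_ifs with h
      · rw [Finset.card_insert_of_notMem (by simp [ha]), h1, h2]
        simp [h] at h3 ⊢
        omega
      · rw [h1, h2]; simp [h]

/-- matrices with a prescribed first column -/
theorem matrixLemma {V J : Type*} [Fintype J] [DecidableEq V] [DecidableEq J] (C : Finset V)
    (c : V → ℕ) (col : J) (E : Finset V) (hE : E ⊆ C) (N : ℕ) (t : J → ℕ)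
    (hc1 : ∀ y ∈ C, 1 ≤ c y) (hck : ∀ y ∈ C, c y ≤ Fintype.card J)
    (hfull : ∀ y ∈ C, c y = Fintype.card J → y ∈ E)
    (htE : t col = #E) (ht : ∀ j, j ≠ col → t j = N ∨ t j = N + 1)
    (hs : ∑ j, t j = ∑ y ∈ C, c y) :
    ∃ T : V → Finset J, (∀ y ∈ C, #(T y) = c y ∧ (col ∈ T y ↔ y ∈ E)) ∧
      ∀ j, #{y ∈ C | j ∈ T y} = t j := by
  have hU : #(univ.erase col) + 1 = Fintype.card J := by
    rw [Finset.card_erase_add_one (mem_univ _), Finset.card_univ]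
  obtain ⟨T, hT1, hT2⟩ := equitable (univ.erase col) C (fun y => c y - if y ∈ E then 1 else 0)
    N t (by
      intro y hy
      have := hck y hy
      have := hfull y hy
      split_ifs with h
      · omega
      · have : c y ≠ Fintype.card J := fun h' => h (this h')
        omega) (by intro j hj; exact ht j (by simpa using hj)) (by
      have h1 : ∑ y ∈ C, (c y - if y ∈ E then 1 else 0) + ∑ y ∈ C, (if y ∈ E then 1 else 0)
          = ∑ y ∈ C, c y := by
        rw [← Finset.sum_add_distrib]
        refine Finset.sum_congr rfl fun y hy => Nat.sub_add_cancel ?_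
        have := hc1 y hy
        split_ifs <;> omega
      have h2 : ∑ y ∈ C, (if y ∈ E then 1 else 0) = #E := by
        rw [← Finset.card_filter, Finset.filter_mem_eq_inter, Finset.inter_eq_right.2 hE]
      have h3 := Finset.add_sum_erase univ t (mem_univ col)
      omega)
  refine ⟨fun y => if y ∈ E then insert col (T y) else T y, ?_, ?_⟩
  · intro y hy
    obtain ⟨h1, h2⟩ := hT1 y hy
    have h3 : col ∉ T y := fun h => by simpa using h1 h
    have := hc1 y hy
    beta_reduce
    split_ifs with h
    · rw [Finset.card_insert_of_notMem h3, h2]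
      simp [h]; omega
    · simp [h, h2, h3]
  · intro j
    by_cases hj : j = col
    · subst hj
      rw [htE]
      congr 1
      ext y
      simp only [mem_filter]
      constructor
      · rintro ⟨hy, h⟩
        by_contra h'
        simp only [h', if_false] at h
        simpa using (hT1 y hy).1 h
      · intro h
        exact ⟨hE h, by simp [h]⟩
    · rw [← hT2 j (by simp [hj])]
      congr 1
      apply Finset.filter_congr
      intro y hy
      beta_reduce
      split_ifs <;> simp [hj]

theorem concludeLemma {V : Type*} [DecidableEq V] {k : ℕ} (w : Finset V → ℕ)
    (hw : ∀ A B : Finset V, A ⊆ B → w A ≤ w B)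
    (B X F : Finset V) (q : ℕ) (hX : #X < k * (q + 1))
    (hF : ∀ F' ⊆ X, #F' ≤ q → w (B ∪ F') ≤ w (B ∪ F))
    (f : V → Fin k) (col : Fin k) (hBF : ∀ y ∈ B ∪ F, f y = col) (hFX : F ⊆ X)
    (hj : ∀ j, j ≠ col → {y ∈ B ∪ X | f y = j} ⊆ X ∧ #{y ∈ B ∪ X | f y = j} ≤ q + 1) :
    (∀ g : V → Fin k, ∃ i, w {y ∈ B ∪ X | g y = i} ≤ w {y ∈ B ∪ X | f y = col}) ∧
    ∀ j, j ≠ col → ∀ x ∈ B ∪ X, f x = j →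
      w ({y ∈ B ∪ X | f y = j}.erase x) ≤ w {y ∈ B ∪ X | f y = col} := by
  have hown : w (B ∪ F) ≤ w {y ∈ B ∪ X | f y = col} := by
    apply hw
    intro y hy
    rw [mem_filter]
    exact ⟨Finset.union_subset_union_right hFX hy, hBF y hy⟩
  constructor
  · intro g
    obtain ⟨i, hi⟩ : ∃ i, #{y ∈ X | g y = i} ≤ q := by
      by_contra! hcon
      have h1 : #X = ∑ i : Fin k, #{y ∈ X | g y = i} :=
        Finset.card_eq_sum_card_fiberwise (fun _ _ => mem_coe.2 (mem_univ _))
      have h2 : ∑ i : Fin k, (q + 1) ≤ ∑ i : Fin k, #{y ∈ X | g y = i} :=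
        Finset.sum_le_sum fun i _ => hcon i
      simp at h2
      omega
    refine ⟨i, le_trans (hw _ _ ?_) ((hF _ (filter_subset _ _) hi).trans hown)⟩
    intro y
    simp only [mem_filter, mem_union]
    tauto
  · intro j hjc x hx hfx
    obtain ⟨h1, h2⟩ := hj j hjc
    have hmem : x ∈ {y ∈ B ∪ X | f y = j} := mem_filter.2 ⟨hx, hfx⟩
    refine le_trans (hw _ _ Finset.subset_union_right) ((hF _ ?_ ?_).trans hown)
    · exact (Finset.erase_subset _ _).trans h1
    · rw [Finset.card_erase_of_mem hmem]; omega

theorem localLemma {V : Type*} [DecidableEq V] {k : ℕ} (C P : Finset V) (hCP : Disjoint C P)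
    (hP : #P ≤ 1) (c : V → ℕ) (hc1 : ∀ y ∈ C, 1 ≤ c y) (hck : ∀ y ∈ C, c y ≤ k)
    (w : Finset V → ℕ) (hw : ∀ A B : Finset V, A ⊆ B → w A ≤ w B)
    (pc : Fin k) (S : Finset (Fin k)) (hS : S.Nonempty) (N : ℕ)
    (hN : ∑ y ∈ C, c y + 1 = N * k + #S) :
    ∃ (col : Fin k) (T : V → Finset (Fin k)),
      (∀ y ∈ C, #(T y) = c y) ∧
      (∀ j, #{y ∈ C | j ∈ T y} + (if col = j then 1 else 0) = N + (if j ∈ S then 1 else 0)) ∧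
      (pc ∈ S → col = pc) ∧ (col ∈ S ∨ col = pc) ∧
      ∀ f : V → Fin k, (∀ y ∈ C, (col ∈ T y → f y = col) ∧ (f y ∈ T y ∨ f y = col)) →
        (∀ p ∈ P, f p = pc) →
        (∀ g : V → Fin k, ∃ i, w {y ∈ C ∪ P | g y = i} ≤ w {y ∈ C ∪ P | f y = col}) ∧
        ∀ j, j ≠ col → ∀ x ∈ C ∪ P, f x = j →
          w ({y ∈ C ∪ P | f y = j}.erase x) ≤ w {y ∈ C ∪ P | f y = col} := by
  classical
  have hk : 0 < k := pc.pos
  have hSk : #S ≤ k := by simpa using Finset.card_le_univ S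
  have hS1 : 1 ≤ #S := hS.card_pos
  set D0 := {y ∈ C | c y = k} with hD0
  set Dp := {y ∈ C | ¬ c y = k} with hDp
  have hDD : D0 ∪ Dp = C := Finset.filter_union_filter_not_eq _ _
  have hsum : k * #D0 + #Dp ≤ ∑ y ∈ C, c y := by
    rw [← Finset.sum_filter_add_sum_filter_not C (fun y => c y = k)]
    apply add_le_add
    · rw [Finset.sum_congr rfl (g := fun _ => k) (fun y hy => (mem_filter.1 hy).2)]
      simp [hD0, mul_comm]
    · rw [hDp, Finset.card_eq_sum_ones]
      exact Finset.sum_le_sum fun y hy => hc1 y (mem_filter.1 hy).1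
  have hsum2 : ∑ y ∈ C, c y ≤ k * #C := by
    rw [mul_comm]
    simpa using Finset.sum_le_card_nsmul C c k hck
  have hND : #D0 ≤ N := by
    by_contra! h
    have : k * (N + 1) ≤ k * #D0 := Nat.mul_le_mul_left _ h
    rw [mul_add, mul_comm k N] at this
    omega
  obtain ⟨q, hq⟩ := Nat.exists_eq_add_of_le hND
  have hDpq : #Dp + 1 ≤ k * q + #S := by
    have : N * k = k * #D0 + k * q := by rw [hq]; ring
    omega
  have hNC : N ≤ #C := by
    by_contra! h
    have : k * (#C + 1) ≤ k * N := Nat.mul_le_mul_left _ h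
    rw [mul_add, mul_comm k N] at this
    omega
  set P0 := if pc ∈ S then P else ∅ with hP0
  set P1 := if pc ∈ S then ∅ else P with hP1
  have hPP : P0 ∪ P1 = P := by
    rw [hP0, hP1]; split_ifs <;> simp
  have hP0P : P0 ⊆ P := hPP ▸ Finset.subset_union_left
  have hP1P : P1 ⊆ P := hPP ▸ Finset.subset_union_right
  set X := Dp ∪ P1 with hX
  set B := D0 ∪ P0 with hB
  have hBX : C ∪ P = B ∪ X := by
    rw [hB, hX, ← hDD, ← hPP]
    ext y; simp only [mem_union]; tauto
  have hXc : #X < k * (q + 1) := by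
    have h1 : #X ≤ #Dp + #P1 := Finset.card_union_le _ _
    have h2 : k * (q + 1) = k * q + k := by ring
    by_cases hpc : pc ∈ S
    · have : #P1 = 0 := by simp [hP1, hpc]
      omega
    · have h3 : #P1 ≤ 1 := (Finset.card_le_card hP1P).trans hP
      have h4 : #S < k := by
        have := Finset.card_lt_univ_of_notMem hpc
        simpa using this
      omega
  obtain ⟨F, hFmem, hFmax⟩ := Finset.exists_max_image {F ∈ X.powerset | #F ≤ q}
    (fun F => w (B ∪ F)) ⟨∅, by simp⟩
  obtain ⟨hFX, hFq⟩ : F ⊆ X ∧ #F ≤ q := by simpa using hFmem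
  have hF : ∀ F' ⊆ X, #F' ≤ q → w (B ∪ F') ≤ w (B ∪ F) := fun F' h1 h2 =>
    hFmax F' (by simp [h1, h2])
  have hnotP : ∀ y ∈ C, y ∉ P := fun y hy hy' => Finset.disjoint_left.1 hCP hy hy'
  have hFD : #(D0 ∪ F ∩ C) ≤ #D0 + #(F ∩ C) := Finset.card_union_le _ _
  have hFC : #(F ∩ C) ≤ #F := Finset.card_le_card Finset.inter_subset_left
  -- the colour of `x`
  obtain ⟨col, M, hcol1, hcol2, hM, hM1, hM2, hcolP⟩ : ∃ (col : Fin k) (M : ℕ),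
      (pc ∈ S → col = pc) ∧ (col ∈ S ∨ col = pc) ∧ M + 1 = N + (if col ∈ S then 1 else 0) ∧
      #(D0 ∪ F ∩ C) ≤ M ∧ M ≤ #C ∧ ∀ p ∈ P, p ∈ P0 ∪ F → col = pc := by
    by_cases hpc : pc ∈ S
    · exact ⟨pc, N, fun _ => rfl, Or.inr rfl, by simp [hpc], by omega, hNC, fun _ _ _ => rfl⟩
    · by_cases hFP : ∃ p ∈ P, p ∈ F
      · obtain ⟨p, hpP, hpF⟩ := hFP
        have : #(F ∩ C) < #F := by
          apply Finset.card_lt_card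
          refine ⟨Finset.inter_subset_left, fun h => ?_⟩
          exact hnotP p (Finset.mem_inter.1 (h hpF)).2 hpP
        exact ⟨pc, N - 1, fun _ => rfl, Or.inr rfl, by simp [hpc]; omega, by omega, by omega,
          fun _ _ _ => rfl⟩
      · obtain ⟨j, hj⟩ := hS
        refine ⟨j, N, fun h => absurd h hpc, Or.inl hj, by simp [hj], by omega, hNC, ?_⟩
        intro p hp hp'
        exfalso
        rcases Finset.mem_union.1 hp' with h | h
        · simp [hP0, hpc] at h
        · exact hFP ⟨p, hp, h⟩
  have hsub : D0 ∪ F ∩ C ⊆ C :=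
    Finset.union_subset (Finset.filter_subset _ _) Finset.inter_subset_right
  obtain ⟨E, hE1, hE2, hE3⟩ := Finset.exists_subsuperset_card_eq hsub hM1 hM2
  set t : Fin k → ℕ := fun j => N + (if j ∈ S then 1 else 0) - (if col = j then 1 else 0) with ht
  have ht' : ∀ j, t j + (if col = j then 1 else 0) = N + (if j ∈ S then 1 else 0) := by
    intro j
    rw [ht]
    by_cases h : col = j
    · subst h
      simp only [if_true]
      omega
    · simp [h]
  obtain ⟨T, hT1, hT2⟩ := matrixLemma C c col E hE2 N t hc1 (by simpa using hck)
    (by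
      intro y hy hyk
      apply hE1
      rw [Fintype.card_fin] at hyk
      simp [hD0, hy, hyk])
    (by
      have := ht' col
      simp only [if_true] at this
      omega)
    (by
      intro j hj
      have := ht' j
      rw [if_neg (Ne.symm hj)] at this
      split_ifs at this <;> omega)
    (by
      have h1 : ∑ j, (t j + (if col = j then 1 else 0)) = ∑ j, (N + (if j ∈ S then 1 else 0)) :=
        Finset.sum_congr rfl fun j _ => ht' j
      rw [Finset.sum_add_distrib, Finset.sum_add_distrib] at h1
      simp [mul_comm k N] at h1
      omega)
  refine ⟨col, T, fun y hy => (hT1 y hy).1, fun j => by rw [hT2]; exact ht' j, hcol1, hcol2, ?_⟩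
  intro f hf hfP
  rw [hBX]
  have hD0T : ∀ y ∈ D0, ∀ j, j ∈ T y := by
    intro y hy j
    obtain ⟨hyC, hyk⟩ := mem_filter.1 hy
    have := (hT1 y hyC).1
    have : T y = univ := by
      apply Finset.eq_univ_of_card
      rw [this, hyk]; simp
    rw [this]; exact mem_univ _
  apply concludeLemma w hw B X F q hXc hF f col ?_ hFX ?_
  · intro y hy
    by_cases hyP : y ∈ P
    · rw [hfP y hyP]
      refine (hcolP y hyP ?_).symm
      rcases Finset.mem_union.1 hy with h | h
      · rcases Finset.mem_union.1 h with h | h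
        · exact absurd hyP (hnotP y (mem_filter.1 h).1)
        · exact Finset.mem_union_left _ h
      · exact Finset.mem_union_right _ h
    · have hyC : y ∈ C := by
        have : y ∈ C ∪ P := by
          rw [hBX]; exact Finset.union_subset_union_right hFX hy
        exact (Finset.mem_union.1 this).resolve_right hyP
      have hyE : y ∈ E := by
        apply hE1
        rcases Finset.mem_union.1 hy with h | h
        · rcases Finset.mem_union.1 h with h | h
          · exact Finset.mem_union_left _ h
          · exact absurd (hP0P h) hyP
        · exact Finset.mem_union_right _ (Finset.mem_inter.2 ⟨h, hyC⟩)
      exact (hf y hyC).1 ((hT1 y hyC).2.2 hyE)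
  · intro j hj
    constructor
    · intro y hy
      obtain ⟨hy1, hy2⟩ := mem_filter.1 hy
      rcases Finset.mem_union.1 hy1 with h | h
      · exfalso
        rcases Finset.mem_union.1 h with h | h
        · have := (hf y (mem_filter.1 h).1).1 (hD0T y h col)
          exact hj (hy2 ▸ this)
        · have h1 := hfP y (hP0P h)
          have : pc ∈ S := by
            by_contra h'
            simp [hP0, h'] at h
          exact hj (by rw [← hy2, h1, hcol1 this])
      · exact h
    · -- count
      have hsplit : {y ∈ B ∪ X | f y = j} ⊆
          ({y ∈ C | j ∈ T y} \ D0) ∪ (if pc = j then P else ∅) := by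
        intro y hy
        rw [← hBX] at hy
        obtain ⟨hy1, hy2⟩ := mem_filter.1 hy
        rcases Finset.mem_union.1 hy1 with h | h
        · apply Finset.mem_union_left
          rw [Finset.mem_sdiff, mem_filter]
          refine ⟨⟨h, ?_⟩, ?_⟩
          · rcases (hf y h).2 with h' | h'
            · exact hy2 ▸ h'
            · exact absurd (hy2.symm.trans h') hj
          · intro h0
            have := (hf y h).1 (hD0T y h0 col)
            exact hj (hy2 ▸ this)
        · apply Finset.mem_union_right
          have := hfP y h
          rw [if_pos (this.symm.trans hy2)]
          exact h
      have h1 := (Finset.card_le_card hsplit).trans (Finset.card_union_le _ _)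
      have h2 : #({y ∈ C | j ∈ T y} \ D0) = t j - #D0 := by
        rw [Finset.card_sdiff_of_subset, hT2]
        intro y hy
        exact mem_filter.2 ⟨(mem_filter.1 hy).1, hD0T y hy j⟩
      have h3 := ht' j
      rw [if_neg (Ne.symm hj)] at h3
      by_cases hpj : pc = j
      · have : j ∉ S := fun h => hj (by rw [hcol1 (hpj ▸ h), hpj])
        rw [if_pos hpj] at h1
        rw [if_neg this] at h3
        omega
      · rw [if_neg hpj, Finset.card_empty] at h1
        split_ifs at h3 <;> omega

theorem tele {V : Type*} [Fintype V] [DecidableEq V] (par : V → V) (r : V) (g h : V → ℕ)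
    (hg : ∀ v, h v + ∑ y with y ≠ r ∧ par y = v, g y = g v) : ∑ v, h v = g r := by
  have h1 : ∑ v, ∑ y with y ≠ r ∧ par y = v, g y = ∑ y with y ≠ r, g y := by
    rw [← Finset.sum_fiberwise (s := {y | y ≠ r}) (g := par)]
    simp only [Finset.filter_filter]
  have h2 : ∑ v, g v = ∑ v, h v + ∑ y with y ≠ r, g y := by
    rw [← h1, ← Finset.sum_add_distrib]
    exact Finset.sum_congr rfl fun v _ => (hg v).symm
  have h3 : ∑ v, g v = g r + ∑ y with y ≠ r, g y := by
    rw [Finset.filter_ne', Finset.add_sum_erase _ _ (mem_univ r)]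
  omega

theorem exists_sigma {V : Type*} [Fintype V] [DecidableEq V] (par : V → V) (dep : V → ℕ) (r : V)
    (hdep : ∀ v, v ≠ r → dep v = dep (par v) + 1) :
    ∃ σ : V → ℕ, ∀ v, σ v = 1 + ∑ y with y ≠ r ∧ par y = v, σ y := by
  let H := univ.sup dep
  have hH : ∀ v, dep v ≤ H := fun v => Finset.le_sup (mem_univ v)
  let f : ℕ → V → ℕ := fun n => Nat.rec (fun _ => 1)
    (fun _ p v => 1 + ∑ y with y ≠ r ∧ par y = v, p y) n
  refine ⟨fun v => f (H - dep v) v, fun v => ?_⟩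
  beta_reduce
  rcases Nat.lt_or_ge (dep v) H with h | h
  · obtain ⟨n, hn⟩ : ∃ n, H - dep v = n + 1 := ⟨H - dep v - 1, by omega⟩
    rw [hn]
    change 1 + ∑ y with y ≠ r ∧ par y = v, f n y = _
    congr 1
    refine Finset.sum_congr rfl fun y hy => ?_
    simp only [mem_filter, mem_univ, true_and] at hy
    have := hdep y hy.1
    rw [hy.2] at this
    congr 1
    omega
  · have : H - dep v = 0 := by omega
    rw [this]
    change 1 = _
    rw [Finset.filter_eq_empty_iff.2]
    · simp
    · rintro y - ⟨h1, h2⟩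
      have := hdep y h1
      have := hH y
      rw [h2] at *
      omega

/-- top-down recursion along the parent function -/
theorem exists_rec {V A : Type*} (par : V → V) (dep : V → ℕ) (r : V)
    (hdep : ∀ v, v ≠ r → dep v = dep (par v) + 1) (s0 : A) (F : V → V → A → A) :
    ∃ st : V → A, st r = s0 ∧ ∀ v, v ≠ r → st v = F v (par v) (st (par v)) := by
  classical
  let f : ℕ → V → A := fun n => Nat.rec (fun _ => s0)
    (fun _ p v => if v = r then s0 else F v (par v) (p (par v))) n
  refine ⟨fun v => f (dep v) v, ?_, fun v hv => ?_⟩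
  · beta_reduce
    cases dep r with
    | zero => rfl
    | succ n => change (if r = r then s0 else _) = s0; simp
  · beta_reduce
    rw [hdep v hv]
    change (if v = r then s0 else _) = _
    rw [if_neg hv]

theorem dep_induction {V : Type*} (par : V → V) (dep : V → ℕ) (r : V)
    (hdep : ∀ v, v ≠ r → dep v = dep (par v) + 1) (Q : V → Prop) (h0 : Q r)
    (hs : ∀ v, v ≠ r → Q (par v) → Q v) (v : V) : Q v := by
  induction hn : dep v generalizing v with
  | zero =>
    by_cases hv : v = r
    · exact hv ▸ h0
    · have := hdep v hv; omega
  | succ n ih =>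
    by_cases hv : v = r
    · exact hv ▸ h0
    · exact hs v hv (ih _ (by have := hdep v hv; omega))

theorem treeMain {V : Type*} [Fintype V] [DecidableEq V] (par : V → V) (dep : V → ℕ) (r : V)
    (hdep : ∀ v, v ≠ r → dep v = dep (par v) + 1) (k : ℕ) (hk : 0 < k) (u : V → Finset V → ℕ)
    (hmono : ∀ a : V, ∀ S T : Finset V, S ⊆ T → u a S ≤ u a T) (Nb : V → Finset V)
    (hNb : ∀ v, Nb v = ({y | y ≠ r ∧ par y = v} : Finset V) ∪ (if v = r then ∅ else {par v})) :
    ∃ π : V → Fin k, (∀ j, Fintype.card V / k ≤ #{v | π v = j} ∧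
      #{v | π v = j} ≤ (Fintype.card V + k - 1) / k) ∧ ∀ a,
      (∀ g : V → Fin k, ∃ i, u a {y ∈ Nb a | g y = i} ≤ u a {y ∈ Nb a | π y = π a}) ∧
      ∀ j, j ≠ π a → ∀ x ∈ Nb a, π x = j →
        u a ({y ∈ Nb a | π y = j}.erase x) ≤ u a {y ∈ Nb a | π y = π a} := by
  classical
  obtain ⟨σ, hσ⟩ := exists_sigma par dep r hdep
  let C : V → Finset V := fun v => {y | y ≠ r ∧ par y = v}
  let P : V → Finset V := fun v => if v = r then ∅ else {par v}
  have hC : ∀ v y, y ∈ C v ↔ y ≠ r ∧ par y = v := by intro v y; simp [C]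
  have hPm : ∀ v y, y ∈ P v ↔ v ≠ r ∧ y = par v := by
    intro v y; by_cases h : v = r <;> simp [P, h]
  have hCP : ∀ v, Disjoint (C v) (P v) := by
    intro v
    rw [Finset.disjoint_left]
    intro y h1 h2
    rw [hC] at h1; rw [hPm] at h2
    have e1 := hdep y h1.1
    have e2 := hdep v h2.1
    rw [h1.2] at e1
    rw [← h2.2] at e2
    omega
  have hP : ∀ v, #(P v) ≤ 1 := by
    intro v; by_cases h : v = r <;> simp [P, h]
  obtain ⟨m, c, hm⟩ : ∃ m c : V → ℕ, ∀ v, σ v = m v * k + c v ∧ 1 ≤ c v ∧ c v ≤ k := by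
    refine ⟨fun v => (σ v - 1) / k, fun v => (σ v - 1) % k + 1, fun v => ?_⟩
    have h1 := hσ v
    have h2 := Nat.mod_lt (σ v - 1) hk
    have h3 := Nat.div_add_mod' (σ v - 1) k
    beta_reduce
    omega
  have hN : ∀ v, ∃ N, m v = N + ∑ y ∈ C v, m y ∧ ∑ y ∈ C v, c y + 1 = N * k + c v := by
    intro v
    have h1 := hσ v
    change σ v = 1 + ∑ y ∈ C v, σ y at h1
    have h2 : ∑ y ∈ C v, σ y = (∑ y ∈ C v, m y) * k + ∑ y ∈ C v, c y := by
      rw [Finset.sum_mul, ← Finset.sum_add_distrib]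
      exact Finset.sum_congr rfl fun y _ => (hm y).1
    rw [h2, (hm v).1] at h1
    have hle : ∑ y ∈ C v, m y ≤ m v := by
      by_contra hlt
      have : (m v + 1) * k ≤ (∑ y ∈ C v, m y) * k := Nat.mul_le_mul_right _ (by omega)
      have h3 := (hm v).2.2
      rw [Nat.add_mul] at this
      omega
    obtain ⟨N, hN⟩ := Nat.exists_eq_add_of_le' hle
    refine ⟨N, hN, ?_⟩
    rw [hN, Nat.add_mul] at h1
    omega
  choose N hN1 hN2 using hN
  have key : ∀ (v : V) (pc : Fin k) (S : Finset (Fin k)), ∃ (col : Fin k) (T : V → Finset (Fin k)),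
      #S = c v → _ := fun v pc S => by
    by_cases h : #S = c v
    · obtain ⟨col, T, h2⟩ := localLemma (C v) (P v) (hCP v) (hP v) c (fun y _ => (hm y).2.1)
        (fun y _ => (hm y).2.2) (u v) (hmono v) pc S
        (Finset.card_pos.1 (by have := (hm v).2.1; omega)) (N v) (by rw [h]; exact hN2 v)
      exact ⟨col, T, fun _ => h2⟩
    · exact ⟨pc, fun _ => ∅, fun h' => absurd h' h⟩
  choose col T hT using key
  obtain ⟨S0, -, hS0⟩ := Finset.exists_subset_card_eq (s := (univ : Finset (Fin k))) (n := c r)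
    (by simpa using (hm r).2.2)
  obtain ⟨st, hst0, hst⟩ := exists_rec par dep r hdep ((⟨0, hk⟩ : Fin k), S0)
    (fun v p s => (col p s.1 s.2, T p s.1 s.2 v))
  have hcard : ∀ v, #(st v).2 = c v := by
    refine dep_induction par dep r hdep _ (by rw [hst0]; exact hS0) ?_
    intro v hv ih
    rw [hst v hv]
    exact (hT _ _ _ ih).1 v ((hC _ _).2 ⟨hv, rfl⟩)
  let π : V → Fin k := fun v => col v (st v).1 (st v).2
  have hch : ∀ x y, y ∈ C x → st y = (π x, T x (st x).1 (st x).2 y) := by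
    intro x y hy
    rw [hC] at hy
    obtain ⟨h1, rfl⟩ := hy
    exact hst y h1
  have hcount : ∀ j, #{v | π v = j} = m r + if j ∈ (st r).2 then 1 else 0 := by
    intro j
    rw [Finset.card_filter]
    refine tele par r (fun v => m v + if j ∈ (st v).2 then 1 else 0) _ fun v => ?_
    change (if π v = j then 1 else 0) + ∑ y ∈ C v, (m y + if j ∈ (st y).2 then 1 else 0) = _
    have h2 := (hT v (st v).1 _ (hcard v)).2.1 j
    rw [Finset.card_filter] at h2
    change _ + (if π v = j then 1 else 0) = _ at h2
    rw [Finset.sum_add_distrib, hN1 v]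
    have h3 : ∑ y ∈ C v, (if j ∈ (st y).2 then 1 else 0)
        = ∑ y ∈ C v, (if j ∈ T v (st v).1 (st v).2 y then 1 else 0) :=
      Finset.sum_congr rfl fun y hy => by rw [hch v y hy]
    rw [h3]
    omega
  have htot : Fintype.card V = m r * k + c r := by
    rw [← (hm r).1, ← tele par r σ (fun _ => 1) fun v => (hσ v).symm]
    simp
  refine ⟨π, fun j => ?_, fun a => ?_⟩
  · rw [hcount, htot]
    obtain ⟨-, hc1, hck⟩ := hm r
    have hcr := hcard r
    rcases hck.lt_or_eq with hlt | heq
    · constructor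
      · rw [mul_comm, Nat.mul_add_div hk, Nat.div_eq_of_lt hlt]; omega
      · rw [Nat.le_div_iff_mul_le hk]
        have : (m r + if j ∈ (st r).2 then 1 else 0) * k ≤ (m r + 1) * k :=
          Nat.mul_le_mul_right _ (by split_ifs <;> omega)
        rw [Nat.add_mul (m r) 1] at this
        omega
    · have hu : (st r).2 = univ := by
        rw [← Finset.card_eq_iff_eq_univ, hcr, heq, Fintype.card_fin]
      rw [hu, heq]
      simp only [mem_univ, if_true]
      have e : m r * k + k = (m r + 1) * k := by ring
      rw [e]
      constructor
      · rw [Nat.mul_div_cancel _ hk]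
      · rw [Nat.le_div_iff_mul_le hk]; omega
  · have hNa : Nb a = C a ∪ P a := hNb a
    rw [hNa]
    obtain ⟨h1, h2, h3, h4, h5⟩ := hT a (st a).1 _ (hcard a)
    refine h5 π ?_ ?_
    · intro y hy
      have h6 := hch a y hy
      obtain ⟨-, -, h7, h8, -⟩ := hT y (st y).1 _ (hcard y)
      rw [h6] at h7 h8
      change π a ∈ T a _ _ y → _ at h7
      have hy' : π y = col y (π a) (T a (st a).1 (st a).2 y) := by
        change col y (st y).1 (st y).2 = _
        rw [h6]
      change (π a ∈ _ → π y = π a) ∧ (π y ∈ _ ∨ π y = π a)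
      rw [hy']
      exact ⟨h7, h8⟩
    · intro p hp
      rw [hPm] at hp
      obtain ⟨h6, rfl⟩ := hp
      rw [hst a h6]

/-- If `G` is a forest, then for every `k` there exists a balanced `k`-partition that
is simultaneously MMS and EFX, even for merely monotone utilities `u` where `u a S`
depends only on `S ∩ Fr(a)`. -/
theorem stmt17 (G : SimpleGraph V) [DecidableRel G.Adj] (hG : G.IsAcyclic)
    (k : ℕ) (hk : 0 < k) (u : V → Finset V → ℕ)
    (hmono : ∀ a : V, ∀ S T : Finset V, S ⊆ T → u a S ≤ u a T)
    (hloc : ∀ (a : V) (S : Finset V), u a S = u a (S ∩ G.neighborFinset a)) :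
    ∃ π : V → Fin k, IsBalanced π ∧
      (∀ a : V,
        sSup {m : ℕ | ∃ π' : V → Fin k, IsBalanced π' ∧ ∀ i : Fin k, m ≤ u a (cell π' i)} ≤
          u a (cell π (π a))) ∧
      ∀ a b : V, ∀ c ∈ (cell π (π b)).erase b, G.Adj a c →
        u a (((cell π (π b)).erase b).erase c) ≤ u a (cell π (π a)) := by
  rcases isEmpty_or_nonempty V with hV | ⟨⟨r⟩⟩
  · refine ⟨fun v => isEmptyElim v, fun i => ?_, fun a => isEmptyElim a, fun a => isEmptyElim a⟩
    have : cell (fun v : V => (isEmptyElim v : Fin k)) i = ∅ := by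
      ext v; exact isEmptyElim v
    rw [this]
    simp
  have : Nonempty V := ⟨r⟩
  obtain ⟨F, hGF, -, hF⟩ :=
    SimpleGraph.connected_top.exists_isTree_le_of_le_of_isAcyclic (le_top : G ≤ ⊤) hG
  obtain ⟨par, dep, hdep, hadj⟩ := orient F hF r
  let Nb : V → Finset V := fun v =>
    ({y | y ≠ r ∧ par y = v} : Finset V) ∪ (if v = r then ∅ else {par v})
  have hsub : ∀ a x, G.Adj a x → x ∈ Nb a := by
    intro a x h
    rcases hadj a x (hGF h) with ⟨h1, h2⟩ | ⟨h1, h2⟩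
    · simp [Nb, h1, h2]
    · simp [Nb, h1, h2]
  have hu : ∀ a S, u a S = u a (S ∩ Nb a) := by
    intro a S
    refine le_antisymm ?_ (hmono _ _ _ inter_subset_left)
    rw [hloc a S]
    refine hmono _ _ _ (inter_subset_inter_left ?_)
    intro x hx
    exact hsub a x (by simpa using hx)
  obtain ⟨π, hbal, hπ⟩ := treeMain par dep r hdep k hk u hmono Nb (fun _ => rfl)
  have hcell : ∀ (g : V → Fin k) i a, cell g i ∩ Nb a = {y ∈ Nb a | g y = i} := by
    intro g i a
    ext y
    simp [cell, and_comm]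
  have hown : ∀ (g : V → Fin k) i a, u a (cell g i) = u a {y ∈ Nb a | g y = i} := by
    intro g i a
    rw [hu, hcell]
  refine ⟨π, hbal, fun a => ?_, fun a b c hc hac => ?_⟩
  · refine csSup_le' ?_
    rintro n ⟨g, -, hg⟩
    obtain ⟨i, hi⟩ := (hπ a).1 g
    refine (hg i).trans ?_
    rw [hown, hown]
    exact hi
  · by_cases hab : π b = π a
    · rw [hab]
      exact hmono _ _ _ ((erase_subset _ _).trans (erase_subset _ _))
    · have hcb : π c = π b := by
        have := (mem_erase.1 hc).2
        simpa [cell] using this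
      refine le_trans ?_ (((hπ a).2 (π b) hab c (hsub a c hac) hcb).trans (hown π (π a) a).ge)
      rw [hu]
      refine hmono _ _ _ ?_
      intro y hy
      simp only [cell, mem_inter, mem_erase, mem_filter, mem_univ, true_and] at hy ⊢
      tauto
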